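/- arXiv:2004.00854 — 2 statements merged into one kernel-verified Lean document; each statement's English description precedes it below -/
import Mathlib

section
/- Every proper holomorphic map f : 𝔻 → 𝔻 of the open unit disc to itself is a finite Blaschke product: there exist m ≥ 1, λ ∈ ℂ with |λ| = 1, and a₁,…,a_m ∈ 𝔻 such that f(z) = λ·∏_{j=1}^m (z−a_j)/(1−conj(a_j)·z) for all z ∈ 𝔻. -/
open Metric Set Complex

noncomputable section

open Filter Topology

/-- The filter of approach to the unit circle from inside the disc. -/
def towardUnitCircle : Filter ℂ := comap (fun z : ℂ => ‖z‖) (𝓝[<] 1)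

lemma eventually_towardUnitCircle {p : ℂ → Prop} :
    (∀ᶠ z in towardUnitCircle, p z) ↔ ∃ r < (1 : ℝ), ∀ z : ℂ, r < ‖z‖ → ‖z‖ < 1 → p z := by
  rw [towardUnitCircle, ((nhdsLT_basis (1 : ℝ)).comap _).eventually_iff]
  simp

lemma eventually_towardUnitCircle_mem_ball :
    ∀ᶠ z in towardUnitCircle, z ∈ ball (0 : ℂ) 1 :=
  eventually_towardUnitCircle.2 ⟨0, one_pos, fun z _ h => by simpa using h⟩

/-- The disc automorphism vanishing at `a`. -/
def blaschkeFactor (a z : ℂ) : ℂ := (z - a) / (1 - (starRingEnd ℂ) a * z)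

lemma one_sub_conj_mul_ne_zero {a z : ℂ} (ha : ‖a‖ < 1) (hz : ‖z‖ < 1) :
    1 - (starRingEnd ℂ) a * z ≠ 0 := by
  intro h
  have h1 : ‖(starRingEnd ℂ) a * z‖ = 1 := by rw [← sub_eq_zero.1 h, norm_one]
  rw [norm_mul, RCLike.norm_conj] at h1
  nlinarith [norm_nonneg a, norm_nonneg z]

lemma norm_sq_one_sub_conj_mul (a z : ℂ) :
    ‖1 - (starRingEnd ℂ) a * z‖ ^ 2 - ‖z - a‖ ^ 2 = (1 - ‖a‖ ^ 2) * (1 - ‖z‖ ^ 2) := by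
  simp only [Complex.sq_norm, Complex.normSq_apply]
  simp
  ring

lemma norm_sq_blaschkeFactor {a z : ℂ} (ha : ‖a‖ < 1) (hz : ‖z‖ < 1) :
    ‖blaschkeFactor a z‖ ^ 2 =
      1 - (1 - ‖a‖ ^ 2) * (1 - ‖z‖ ^ 2) / ‖1 - (starRingEnd ℂ) a * z‖ ^ 2 := by
  have h := norm_ne_zero_iff.2 (one_sub_conj_mul_ne_zero ha hz)
  rw [← norm_sq_one_sub_conj_mul, blaschkeFactor, norm_div, div_pow, sub_div,
    div_self (pow_ne_zero 2 h), sub_sub_cancel]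

lemma norm_blaschkeFactor_lt_one {a z : ℂ} (ha : ‖a‖ < 1) (hz : ‖z‖ < 1) :
    ‖blaschkeFactor a z‖ < 1 := by
  have h := norm_pos_iff.2 (one_sub_conj_mul_ne_zero ha hz)
  have ha' : 0 < 1 - ‖a‖ ^ 2 := by nlinarith [norm_nonneg a]
  have hz' : 0 < 1 - ‖z‖ ^ 2 := by nlinarith [norm_nonneg z]
  have hpos : 0 < (1 - ‖a‖ ^ 2) * (1 - ‖z‖ ^ 2) / ‖1 - (starRingEnd ℂ) a * z‖ ^ 2 := by
    positivity
  have := norm_sq_blaschkeFactor ha hz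
  nlinarith [norm_nonneg (blaschkeFactor a z)]

lemma tendsto_norm_blaschkeFactor {a : ℂ} (ha : ‖a‖ < 1) :
    Tendsto (fun z => ‖blaschkeFactor a z‖) towardUnitCircle (𝓝 1) := by
  have hnorm : Tendsto (fun z : ℂ => ‖z‖) towardUnitCircle (𝓝 1) :=
    tendsto_comap.mono_right nhdsWithin_le_nhds
  have hlow : Tendsto (fun z : ℂ => 1 - (1 - ‖a‖ ^ 2) * (1 - ‖z‖ ^ 2) / (1 - ‖a‖) ^ 2)
      towardUnitCircle (𝓝 1) := by
    have := (((hnorm.pow 2).const_sub 1).const_mul (1 - ‖a‖ ^ 2)).div_const ((1 - ‖a‖) ^ 2)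
    simpa using this.const_sub 1
  have hsq : Tendsto (fun z => ‖blaschkeFactor a z‖ ^ 2) towardUnitCircle (𝓝 1) := by
    refine tendsto_of_tendsto_of_tendsto_of_le_of_le' hlow tendsto_const_nhds ?_ ?_
    · filter_upwards [eventually_towardUnitCircle_mem_ball] with z hz
      rw [mem_ball_zero_iff] at hz
      rw [norm_sq_blaschkeFactor ha hz]
      have ha' : 0 < 1 - ‖a‖ ^ 2 := by nlinarith [norm_nonneg a]
      have hz' : 0 < 1 - ‖z‖ ^ 2 := by nlinarith [norm_nonneg z]
      have ha1 : 0 < 1 - ‖a‖ := by linarith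
      have hle : 1 - ‖a‖ ≤ ‖1 - (starRingEnd ℂ) a * z‖ := by
        have h1 := norm_sub_norm_le (1 : ℂ) ((starRingEnd ℂ) a * z)
        rw [norm_one, norm_mul, RCLike.norm_conj] at h1
        nlinarith [norm_nonneg a, norm_nonneg z]
      gcongr
    · filter_upwards [eventually_towardUnitCircle_mem_ball] with z hz
      rw [mem_ball_zero_iff] at hz
      exact pow_le_one₀ (norm_nonneg _) (norm_blaschkeFactor_lt_one ha hz).le
  simpa [Real.sqrt_sq (norm_nonneg _)] using hsq.sqrt

lemma norm_le_one_of_tendsto_norm {g : ℂ → ℂ} (hg : DifferentiableOn ℂ g (ball 0 1))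
    (hlim : Tendsto (fun z => ‖g z‖) towardUnitCircle (𝓝 1)) {z : ℂ} (hz : ‖z‖ < 1) :
    ‖g z‖ ≤ 1 := by
  refine le_of_forall_pos_le_add fun ε hε => ?_
  obtain ⟨r, hr, h⟩ := eventually_towardUnitCircle.1
    (hlim.eventually (gt_mem_nhds (show (1 : ℝ) < 1 + ε by linarith)))
  obtain ⟨s, hs, hs1⟩ := exists_between (max_lt hr hz)
  obtain ⟨hrs, hzs⟩ := max_lt_iff.1 hs
  have hs0 : s ≠ 0 := ((norm_nonneg z).trans_lt hzs).ne'
  have hd : DiffContOnCl ℂ g (ball 0 s) := by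
    refine DifferentiableOn.diffContOnCl (hg.mono ?_)
    rw [closure_ball _ hs0]
    exact closedBall_subset_ball hs1
  refine norm_le_of_forall_mem_frontier_norm_le isBounded_ball hd (fun w hw => ?_)
    (subset_closure (by simpa using hzs))
  rw [frontier_ball _ hs0, mem_sphere_zero_iff_norm] at hw
  exact (h w (hw ▸ hrs) (hw ▸ hs1)).le

lemma exists_eq_const_of_norm_eq_one {g : ℂ → ℂ} (hg : DifferentiableOn ℂ g (ball 0 1))
    (hle : ∀ z : ℂ, ‖z‖ < 1 → ‖g z‖ ≤ 1) {p : ℂ} (hp : ‖p‖ < 1) (hgp : 1 ≤ ‖g p‖) :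
    ∃ lam : ℂ, ‖lam‖ = 1 ∧ ∀ z ∈ ball (0 : ℂ) 1, g z = lam := by
  refine ⟨g p, le_antisymm (hle p hp) hgp, fun z hz => ?_⟩
  refine Complex.eqOn_of_isPreconnected_of_isMaxOn_norm (convex_ball (0 : ℂ) 1).isPreconnected
    isOpen_ball hg (by simpa using hp) (fun w hw => ?_) hz
  exact (hle w (by simpa using hw)).trans hgp

/-- Dividing out a zero. -/
lemma exists_eq_blaschkeFactor_mul {g : ℂ → ℂ} (hg : DifferentiableOn ℂ g (ball 0 1))
    (hlim : Tendsto (fun z => ‖g z‖) towardUnitCircle (𝓝 1)) {a : ℂ} (ha : ‖a‖ < 1)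
    (hga : g a = 0) :
    ∃ h : ℂ → ℂ, DifferentiableOn ℂ h (ball 0 1) ∧
      Tendsto (fun z => ‖h z‖) towardUnitCircle (𝓝 1) ∧
      ∀ z ∈ ball (0 : ℂ) 1, g z = blaschkeFactor a z * h z := by
  have hfac : ∀ z ∈ ball (0 : ℂ) 1,
      g z = blaschkeFactor a z * (dslope g a z * (1 - (starRingEnd ℂ) a * z)) := by
    intro z hz
    have hne := one_sub_conj_mul_ne_zero ha (by simpa using hz : ‖z‖ < 1)
    have h := sub_smul_dslope g a z
    rw [hga, sub_zero, smul_eq_mul] at h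
    rw [← h, blaschkeFactor, div_mul_eq_mul_div, eq_div_iff hne, mul_assoc]
  refine ⟨_, ?_, ?_, hfac⟩
  · have : DifferentiableOn ℂ (dslope g a) (ball 0 1) :=
      (Complex.differentiableOn_dslope (isOpen_ball.mem_nhds (by simpa using ha))).2 hg
    exact this.mul (by fun_prop)
  · have hb := tendsto_norm_blaschkeFactor ha
    have hdiv := hlim.div hb one_ne_zero
    rw [div_one] at hdiv
    refine hdiv.congr' ?_
    filter_upwards [eventually_towardUnitCircle_mem_ball,
      hb.eventually (lt_mem_nhds one_pos)] with z hz hpos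
    simp only [Pi.div_apply]
    rw [hfac z hz, norm_mul, mul_div_cancel_left₀ _ hpos.ne']

lemma exists_blaschkeProduct_of_pow_le {p : ℂ} (hp : ‖p‖ < 1) {r c : ℝ} (hr : r < 1)
    (hc : 0 < c) (hpc : ∀ a : ℂ, ‖a‖ ≤ r → ‖blaschkeFactor a p‖ ≤ c) (n : ℕ) :
    ∀ g : ℂ → ℂ, DifferentiableOn ℂ g (ball 0 1) →
      Tendsto (fun z => ‖g z‖) towardUnitCircle (𝓝 1) →
      (∀ z ∈ ball (0 : ℂ) 1, g z = 0 → ‖z‖ ≤ r) → c ^ n ≤ ‖g p‖ →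
      ∃ (m : ℕ) (lam : ℂ), ‖lam‖ = 1 ∧ ∃ a : Fin m → ℂ, (∀ j, ‖a j‖ < 1) ∧
        ∀ z ∈ ball (0 : ℂ) 1, g z = lam * ∏ j, blaschkeFactor (a j) z := by
  induction n with
  | zero =>
    intro g hg hlim _ hgp
    obtain ⟨lam, hlam, h⟩ := exists_eq_const_of_norm_eq_one hg
      (fun z hz => norm_le_one_of_tendsto_norm hg hlim hz) hp (by simpa using hgp)
    exact ⟨0, lam, hlam, Fin.elim0, fun j => j.elim0, by simpa using h⟩
  | succ n ih =>
    intro g hg hlim hzero hgp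
    by_cases hex : ∃ a ∈ ball (0 : ℂ) 1, g a = 0
    · obtain ⟨a, ha, hga⟩ := hex
      have har := hzero a ha hga
      obtain ⟨h, hh, hhlim, hfac⟩ := exists_eq_blaschkeFactor_mul hg hlim (har.trans_lt hr) hga
      have hhp : c ^ n ≤ ‖h p‖ := by
        rw [hfac p (by simpa using hp), norm_mul, pow_succ'] at hgp
        exact le_of_mul_le_mul_left
          (hgp.trans (mul_le_mul_of_nonneg_right (hpc a har) (norm_nonneg _))) hc
      obtain ⟨m, lam, hlam, b, hb, hprod⟩ := ih h hh hhlim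
        (fun z hz h0 => hzero z hz (by rw [hfac z hz, h0, mul_zero])) hhp
      refine ⟨m + 1, lam, hlam, Fin.cons a b, Fin.cases (har.trans_lt hr) hb, fun z hz => ?_⟩
      rw [hfac z hz, hprod z hz, Fin.prod_univ_succ]
      simp only [Fin.cons_zero, Fin.cons_succ]
      ring
    · push Not at hex
      have hinv : Tendsto (fun z => ‖(g z)⁻¹‖) towardUnitCircle (𝓝 1) := by
        simpa using hlim.inv₀ one_ne_zero
      have hle := norm_le_one_of_tendsto_norm (hg.fun_inv hex) hinv hp
      rw [norm_inv] at hle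
      have hgp1 : 1 ≤ ‖g p‖ :=
        (inv_le_one₀ (norm_pos_iff.2 (hex p (by simpa using hp)))).1 hle
      obtain ⟨lam, hlam, h⟩ := exists_eq_const_of_norm_eq_one hg
        (fun z hz => norm_le_one_of_tendsto_norm hg hlim hz) hp hgp1
      exact ⟨0, lam, hlam, Fin.elim0, fun j => j.elim0, by simpa using h⟩

lemma exists_blaschkeProduct_of_tendsto_norm {g : ℂ → ℂ} (hg : DifferentiableOn ℂ g (ball 0 1))
    (hlim : Tendsto (fun z => ‖g z‖) towardUnitCircle (𝓝 1)) :
    ∃ (m : ℕ) (lam : ℂ), ‖lam‖ = 1 ∧ ∃ a : Fin m → ℂ, (∀ j, ‖a j‖ < 1) ∧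
      ∀ z ∈ ball (0 : ℂ) 1, g z = lam * ∏ j, blaschkeFactor (a j) z := by
  obtain ⟨r₀, hr₀, h₀⟩ := eventually_towardUnitCircle.1 (hlim.eventually (lt_mem_nhds one_pos))
  obtain ⟨r, hr, hr1⟩ := exists_between (max_lt hr₀ one_pos)
  obtain ⟨hr₀r, hr0⟩ := max_lt_iff.1 hr
  have hpos : ∀ z : ℂ, r ≤ ‖z‖ → ‖z‖ < 1 → 0 < ‖g z‖ := fun z hz => h₀ z (hr₀r.trans_le hz)
  have hrn : ‖(r : ℂ)‖ = r := by simp [abs_of_pos hr0]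
  have hp : ‖(r : ℂ)‖ < 1 := hrn.trans_lt hr1
  have hcont : ContinuousOn (fun a : ℂ => ‖blaschkeFactor a r‖) (closedBall 0 r) := by
    refine (ContinuousOn.div (by fun_prop) ?_ fun a ha => ?_).norm
    · exact (continuous_const.sub (Complex.continuous_conj.mul continuous_const)).continuousOn
    · exact one_sub_conj_mul_ne_zero
        ((mem_closedBall_zero_iff.1 ha).trans_lt hr1) hp
  obtain ⟨b, hb, hmax⟩ := (isCompact_closedBall (0 : ℂ) r).exists_isMaxOn
    ⟨0, mem_closedBall_self hr0.le⟩ hcont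
  have hb1 := norm_blaschkeFactor_lt_one ((mem_closedBall_zero_iff.1 hb).trans_lt hr1) hp
  obtain ⟨c, hbc, hc1⟩ := exists_between hb1
  have hc0 : 0 < c := (norm_nonneg _).trans_lt hbc
  obtain ⟨n, hn⟩ := exists_pow_lt_of_lt_one (hpos r hrn.ge hp) hc1
  refine exists_blaschkeProduct_of_pow_le hp hr1 hc0
    (fun a ha => (hmax (mem_closedBall_zero_iff.2 ha)).trans hbc.le) n g hg hlim
    (fun z hz h0 => ?_) hn.le
  by_contra! hlt
  exact (hpos z hlt.le (mem_ball_zero_iff.1 hz)).ne' (by rw [h0, norm_zero])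

lemma tendsto_norm_of_isCompact_preimage {f : ℂ → ℂ}
    (hfm : Set.MapsTo f (ball (0 : ℂ) 1) (ball (0 : ℂ) 1))
    (hproper : ∀ K : Set ℂ, K ⊆ ball (0 : ℂ) 1 → IsCompact K →
      IsCompact (ball (0 : ℂ) 1 ∩ f ⁻¹' K)) :
    Tendsto (fun z => ‖f z‖) towardUnitCircle (𝓝 1) := by
  refine tendsto_order.2 ⟨fun b hb => ?_, fun b hb => ?_⟩
  · have hK := hproper (closedBall 0 b) (closedBall_subset_ball hb) (isCompact_closedBall 0 b)
    rw [eventually_towardUnitCircle]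
    rcases (ball (0 : ℂ) 1 ∩ f ⁻¹' closedBall 0 b).eq_empty_or_nonempty with hempty | hne
    · refine ⟨0, one_pos, fun z _ hz => ?_⟩
      by_contra! hle
      exact notMem_empty z (hempty ▸ ⟨mem_ball_zero_iff.2 hz, mem_closedBall_zero_iff.2 hle⟩)
    · obtain ⟨w, hw, hmax⟩ := hK.exists_isMaxOn hne continuous_norm.continuousOn
      refine ⟨‖w‖, mem_ball_zero_iff.1 hw.1, fun z hwz hz => ?_⟩
      by_contra! hle
      exact hwz.not_ge (hmax ⟨mem_ball_zero_iff.2 hz, mem_closedBall_zero_iff.2 hle⟩)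
  · filter_upwards [eventually_towardUnitCircle_mem_ball] with z hz
    exact (mem_ball_zero_iff.1 (hfm hz)).trans hb

/-- every proper holomorphic self-map of the open unit disc `𝔻` is a finite
Blaschke product. -/
theorem stmt8 (f : ℂ → ℂ)
    (hf : DifferentiableOn ℂ f (ball (0 : ℂ) 1))
    (hfm : Set.MapsTo f (ball (0 : ℂ) 1) (ball (0 : ℂ) 1))
    (hproper : ∀ K : Set ℂ, K ⊆ ball (0 : ℂ) 1 → IsCompact K →
      IsCompact (ball (0 : ℂ) 1 ∩ f ⁻¹' K)) :
    ∃ (m : ℕ), 1 ≤ m ∧ ∃ (lam : ℂ), ‖lam‖ = 1 ∧ ∃ a : Fin m → ℂ,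
      (∀ j, ‖a j‖ < 1) ∧
      ∀ z ∈ ball (0 : ℂ) 1,
        f z = lam * ∏ j, (z - a j) / (1 - (starRingEnd ℂ) (a j) * z) := by
  obtain ⟨m, lam, hlam, a, ha, h⟩ := exists_blaschkeProduct_of_tendsto_norm hf
    (tendsto_norm_of_isCompact_preimage hfm hproper)
  refine ⟨m, ?_, lam, hlam, a, ha, h⟩
  rw [Nat.one_le_iff_ne_zero]
  rintro rfl
  have h0 : (0 : ℂ) ∈ ball (0 : ℂ) 1 := mem_ball_self one_pos
  have h1 := mem_ball_zero_iff.1 (hfm h0)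
  rw [h 0 h0] at h1
  simp [hlam] at h1
end
end

section
/- Let B₀ be a finite Blaschke product with trivial group of deck transformations, i.e. the only holomorphic bijection φ : 𝔻 → 𝔻 satisfying B₀∘φ = B₀ is the identity, and let f : G_d → G_d be the proper holomorphic map determined by f(s(z₁,…,z_d)) = s(B₀(z₁),…,B₀(z_d)) for z ∈ 𝔻^d. Then every biholomorphism Φ : G_d → G_d satisfying f∘Φ = f is the identity map of G_d. -/
open Metric Set Complex

noncomputable section

/-- The unit polydisc `𝔻^d` in `ℂ^d`. -/
def polydisc (d : ℕ) : Set (Fin d → ℂ) := {z | ∀ i, z i ∈ ball (0 : ℂ) 1}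

/-- The symmetrization map `s : ℂ^d → ℂ^d` (elementary symmetric polynomials). -/
def symmMap (d : ℕ) (z : Fin d → ℂ) : Fin d → ℂ :=
  fun i => ∑ t ∈ Finset.univ.powersetCard ((i : ℕ) + 1), ∏ j ∈ t, z j

/-- The symmetrized polydisc `G_d = s(𝔻^d)`. -/
def symPolydisc (d : ℕ) : Set (Fin d → ℂ) := symmMap d '' polydisc d

open Filter Topology

theorem exists_equiv_of_map_univ_eq {ι α : Type*} [Fintype ι] {u v : ι → α}
    (h : Finset.univ.val.map u = Finset.univ.val.map v) : ∃ σ : ι ≃ ι, ∀ i, v (σ i) = u i := by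
  classical
  have key (b : α) : Nonempty ({i // u i = b} ≃ {i // v i = b}) := by
    refine ⟨Fintype.equivOfCardEq ?_⟩
    have hb := congrArg (Multiset.count b) h
    rw [Multiset.count_map, Multiset.count_map] at hb
    rw [Fintype.card_subtype, Fintype.card_subtype]
    simpa [Finset.card_def, eq_comm] using hb
  exact ⟨Equiv.ofFiberEquiv fun b => (key b).some, fun i => Equiv.ofFiberEquiv_map _ i⟩

theorem symmMap_comp_equiv {d : ℕ} (z : Fin d → ℂ) (σ : Fin d ≃ Fin d) :
    symmMap d (z ∘ σ) = symmMap d z := by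
  funext i
  simp only [symmMap, ← Finset.esymm_map_val]
  congr 1
  rw [← Multiset.map_map]
  congr 1
  simp

/-- The monic polynomial with coefficients `x` up to sign. -/
def vietaEval (d : ℕ) (x : Fin d → ℂ) (t : ℂ) : ℂ :=
  t ^ d + ∑ i : Fin d, (-1) ^ ((i : ℕ) + 1) * (x i * t ^ (d - ((i : ℕ) + 1)))

theorem prod_sub_eq_vietaEval {d : ℕ} (z : Fin d → ℂ) (t : ℂ) :
    ∏ j, (t - z j) = vietaEval d (symmMap d z) t := by
  have h := congrArg (Polynomial.eval t)
    (Multiset.prod_X_sub_X_eq_sum_esymm (Finset.univ.val.map z))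
  rw [Polynomial.eval_multiset_prod, Polynomial.eval_finsetSum] at h
  simp only [Multiset.map_map, Multiset.card_map, Finset.card_val, Finset.card_univ,
    Fintype.card_fin, Finset.sum_range_succ', Finset.esymm_map_val, Finset.prod_map_val] at h
  simp only [vietaEval, symmMap]
  rw [Finset.sum_range] at h
  simpa [add_comm, Polynomial.eval_finsetSum, Polynomial.eval_prod, -Fin.univ_val_map,
    Finset.prod_map_val] using h

theorem map_univ_eq_of_symmMap_eq {d : ℕ} {z w : Fin d → ℂ} (h : symmMap d z = symmMap d w) :
    Finset.univ.val.map z = Finset.univ.val.map w := by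
  have hp : ∏ j, (Polynomial.X - Polynomial.C (z j)) =
      ∏ j, (Polynomial.X - Polynomial.C (w j)) := by
    refine Polynomial.funext fun t => ?_
    simp only [Polynomial.eval_prod, Polynomial.eval_sub, Polynomial.eval_X, Polynomial.eval_C,
      prod_sub_eq_vietaEval, h]
  have hr (u : Fin d → ℂ) :
      (∏ j, (Polynomial.X - Polynomial.C (u j))).roots = Finset.univ.val.map u := by
    have := Polynomial.roots_multiset_prod_X_sub_C (Finset.univ.val.map u)
    rwa [Multiset.map_map] at this
  rw [← hr z, ← hr w, hp]

theorem exists_equiv_of_symmMap_eq {d : ℕ} {z w : Fin d → ℂ} (h : symmMap d z = symmMap d w) :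
    ∃ σ : Fin d ≃ Fin d, ∀ i, w (σ i) = z i :=
  exists_equiv_of_map_univ_eq (map_univ_eq_of_symmMap_eq h)

theorem eq_of_symmMap_const_eq {d : ℕ} {a b : ℂ} (i : Fin d)
    (h : symmMap d (fun _ => a) = symmMap d (fun _ => b)) : a = b :=
  let ⟨_, hσ⟩ := exists_equiv_of_symmMap_eq h
  (hσ i).symm

theorem differentiable_symmMap (d : ℕ) : Differentiable ℂ (symmMap d) := by
  unfold symmMap
  fun_prop

theorem symmMap_const_zero {d : ℕ} (hd : 0 < d) (c : ℂ) :
    symmMap d (fun _ => c) ⟨0, hd⟩ = d * c := by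
  simp [symmMap, Finset.powersetCard_one]

theorem isOpen_polydisc (d : ℕ) : IsOpen (polydisc d) := by
  simp only [polydisc, ofPred_forall]
  exact isOpen_iInter_of_finite fun i => isOpen_ball.preimage (continuous_apply i)

theorem convex_polydisc (d : ℕ) : Convex ℝ (polydisc d) := by
  intro x hx y hy a b ha hb hab i
  exact convex_ball (0 : ℂ) 1 (hx i) (hy i) ha hb hab

/-- The identity theorem on convex open sets of a complex normed space. -/
theorem eqOn_of_convex_of_eventuallyEq {E F : Type*} [NormedAddCommGroup E] [NormedSpace ℂ E]
    [NormedAddCommGroup F] [NormedSpace ℂ F] [CompleteSpace F] {V : Set E} (hV : IsOpen V)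
    (hc : Convex ℝ V) {g₁ g₂ : E → F} (h₁ : DifferentiableOn ℂ g₁ V)
    (h₂ : DifferentiableOn ℂ g₂ V) {p : E} (hp : p ∈ V) (h : g₁ =ᶠ[𝓝 p] g₂) :
    EqOn g₁ g₂ V := by
  intro q hq
  let ℓ : ℂ → E := fun t => p + t • (q - p)
  have hℓ : Differentiable ℂ ℓ := by fun_prop
  have hℓ0 : ℓ 0 = p := by simp [ℓ]
  have hℓ1 : ℓ 1 = q := by simp [ℓ]
  have hWo : IsOpen (ℓ ⁻¹' V) := hV.preimage hℓ.continuous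
  have hWc : Convex ℝ (ℓ ⁻¹' V) := by
    intro x hx y hy a b ha hb hab
    have : ℓ (a • x + b • y) = a • ℓ x + b • ℓ y := by
      simp only [ℓ, smul_add, add_smul, smul_assoc]
      rw [add_add_add_comm, ← add_smul, hab, one_smul]
    rw [mem_preimage, this]
    exact hc hx hy ha hb hab
  have han {g : E → F} (hg : DifferentiableOn ℂ g V) : AnalyticOnNhd ℂ (g ∘ ℓ) (ℓ ⁻¹' V) :=
    (hg.comp hℓ.differentiableOn (mapsTo_preimage ℓ V)).analyticOnNhd hWo
  have hev : g₁ ∘ ℓ =ᶠ[𝓝 0] g₂ ∘ ℓ := by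
    have : Tendsto ℓ (𝓝 0) (𝓝 p) := by simpa [hℓ0] using hℓ.continuous.tendsto 0
    exact this.eventually h
  have := (han h₁).eqOn_of_preconnected_of_eventuallyEq (han h₂) hWc.isPreconnected
    (show (0 : ℂ) ∈ ℓ ⁻¹' V by simpa [hℓ0] using hp) hev
    (show (1 : ℂ) ∈ ℓ ⁻¹' V by simpa [hℓ1] using hq)
  simpa [hℓ1] using this

/-- A finite family of identities covering a convex open set contains an identity valid on the
whole set. -/
theorem exists_eqOn_of_forall_exists_eq {ι E F : Type*} [Finite ι] [NormedAddCommGroup E]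
    [NormedSpace ℂ E] [CompleteSpace E] [NormedAddCommGroup F] [NormedSpace ℂ F] [CompleteSpace F]
    {V : Set E} (hV : IsOpen V) (hc : Convex ℝ V) (hne : V.Nonempty) {g : E → F} {k : ι → E → F}
    (hg : DifferentiableOn ℂ g V) (hk : ∀ i, DifferentiableOn ℂ (k i) V)
    (h : ∀ z ∈ V, ∃ i, g z = k i z) : ∃ i, EqOn g (k i) V := by
  have hopen (i : ι) : IsOpen (V ∩ {z | g z ≠ k i z}) := by
    have := ((hg.continuousOn.sub (hk i).continuousOn).isOpen_inter_preimage hV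
      (isOpen_compl_singleton (x := (0 : F))))
    convert this using 2
    ext z
    simp [sub_eq_zero]
  have hcover : ⋃ i, (V ∩ {z | g z ≠ k i z})ᶜ = univ := by
    refine eq_univ_of_forall fun z => mem_iUnion.2 ?_
    by_cases hz : z ∈ V
    · obtain ⟨i, hi⟩ := h z hz
      exact ⟨i, fun hz' => hz'.2 hi⟩
    · obtain ⟨i, -⟩ := h _ hne.some_mem
      exact ⟨i, fun hz' => hz hz'.1⟩
  obtain ⟨p, hpV, hp⟩ := (dense_iUnion_interior_of_closed
    (fun i => (hopen i).isClosed_compl) hcover).inter_open_nonempty V hV hne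
  obtain ⟨i, hi⟩ := mem_iUnion.1 hp
  refine ⟨i, eqOn_of_convex_of_eventuallyEq hV hc hg (hk i) hpV ?_⟩
  filter_upwards [mem_interior_iff_mem_nhds.1 hi, hV.mem_nhds hpV] with z hz hzV
  by_contra hne'
  exact hz ⟨hzV, hne'⟩

/-- A nonconstant holomorphic function on the disc has a noncritical value. -/
theorem exists_fiber_deriv_ne_zero {B : ℂ → ℂ} (hB : DifferentiableOn ℂ B (ball 0 1))
    (hnc : ¬ ∃ c, ∀ z ∈ ball (0 : ℂ) 1, B z = c) :
    ∃ z₀ ∈ ball (0 : ℂ) 1, ∀ w ∈ ball (0 : ℂ) 1, B w = B z₀ → deriv B w ≠ 0 := by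
  have hpre : IsPreconnected (ball (0 : ℂ) 1) := (convex_ball _ _).isPreconnected
  have hB' : AnalyticOnNhd ℂ B (ball 0 1) := hB.analyticOnNhd isOpen_ball
  have hopen : IsOpen (B '' ball 0 1) :=
    (hB'.is_constant_or_isOpen hpre).resolve_left hnc _ subset_rfl isOpen_ball
  have hiso : ∀ x ∈ ball (0 : ℂ) 1, {y | y ≠ x → deriv B y ≠ 0} ∈ 𝓝[ball 0 1] x := by
    intro x hx
    refine mem_nhdsWithin_of_mem_nhds ?_
    rcases (hB'.deriv x hx).eventually_eq_zero_or_eventually_ne_zero with h | h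
    · exfalso
      have hz := hB'.deriv.eqOn_zero_of_preconnected_of_eventuallyEq_zero hpre hx h
      exact hnc ⟨B 0, fun z hz' => isOpen_ball.is_const_of_deriv_eq_zero hpre hB hz hz' (by simp)⟩
    · exact eventually_nhdsWithin_iff.1 h
  obtain ⟨t, -, htc, ht⟩ := TopologicalSpace.countable_cover_nhdsWithin hiso
  obtain ⟨c, ⟨z₀, hz₀, rfl⟩, hc⟩ := ((htc.image B).dense_compl ℂ).inter_open_nonempty _ hopen
    ((nonempty_ball.2 one_pos).image B)
  refine ⟨z₀, hz₀, fun w hw hwz hder => hc ?_⟩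
  obtain ⟨x, hx, hwx⟩ := mem_iUnion₂.1 (ht hw)
  refine ⟨x, hx, ?_⟩
  rw [← hwz]
  by_contra hne
  exact hwx (fun h => hne (by rw [h])) hder

/-- The roots of a polynomial are close to those of a fixed one when the coefficients are. -/
theorem eventually_forall_exists_mem_of_symmMap_eq {d : ℕ} {w₀ : Fin d → ℂ} {N : Fin d → Set ℂ}
    (hN : ∀ j, N j ∈ 𝓝 (w₀ j)) :
    ∀ᶠ x in 𝓝 (symmMap d w₀), ∀ w ∈ polydisc d, symmMap d w = x → ∀ k, ∃ j, w k ∈ N j := by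
  have hε : ∀ᶠ ε : ℝ in 𝓝[>] 0, ∀ j, ball (w₀ j) ε ⊆ N j := by
    refine eventually_all.2 fun j => ?_
    obtain ⟨r, hr, hrN⟩ := Metric.mem_nhds_iff.1 (hN j)
    filter_upwards [Ioo_mem_nhdsGT hr] with ε hε
    exact (ball_subset_ball hε.2.le).trans hrN
  obtain ⟨ε, hεN, hε0⟩ := (hε.and self_mem_nhdsWithin).exists
  have hcont : Continuous fun x : Fin d → ℂ => ∑ i, ‖symmMap d w₀ i - x i‖ := by fun_prop
  have hlt : ∀ᶠ x in 𝓝 (symmMap d w₀), ∑ i, ‖symmMap d w₀ i - x i‖ < ε ^ d :=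
    hcont.continuousAt.eventually_lt_const (by simpa using pow_pos hε0 d)
  filter_upwards [hlt] with x hx w hw hwx k
  by_contra! hk
  have hfar (j : Fin d) : ε ≤ ‖w k - w₀ j‖ := by
    by_contra! hj
    exact hk j (hεN j (by simpa [dist_eq_norm] using hj))
  have hwk : ‖w k‖ ≤ 1 := by simpa using (mem_ball_zero_iff.1 (hw k)).le
  refine hx.not_ge ?_
  calc ε ^ d = ∏ _j : Fin d, ε := by simp
    _ ≤ ∏ j, ‖w k - w₀ j‖ := Finset.prod_le_prod (fun _ _ => hε0.le) fun j _ => hfar j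
    _ = ‖vietaEval d (symmMap d w₀) (w k) - vietaEval d (symmMap d w) (w k)‖ := by
      rw [← prod_sub_eq_vietaEval w, ← norm_prod, prod_sub_eq_vietaEval,
        Finset.prod_eq_zero (Finset.mem_univ k) (sub_self _), sub_zero]
    _ = ‖∑ i : Fin d, (-1) ^ ((i : ℕ) + 1) *
          ((symmMap d w₀ i - x i) * w k ^ (d - ((i : ℕ) + 1)))‖ := by
      simp only [vietaEval, add_sub_add_left_eq_sub, ← Finset.sum_sub_distrib, ← mul_sub,
        ← sub_mul, hwx]
    _ ≤ ∑ i, ‖symmMap d w₀ i - x i‖ := by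
      refine norm_sum_le_of_le _ fun i _ => ?_
      simp only [norm_mul, norm_pow, norm_neg, norm_one, one_pow, one_mul]
      exact mul_le_of_le_one_right (norm_nonneg _) (pow_le_one₀ (norm_nonneg _) hwk)

/-- If each coordinate of the symmetrized map is described by a branch, symmetry forces the
branches to coincide. -/
theorem eqOn_of_forall_eq_symmMap {d : ℕ} {U : Set ℂ} (hU : ∀ ζ, ∃ ξ ∈ U, ξ ≠ ζ) {B : ℂ → ℂ}
    (hinj : InjOn B U) {h : Fin d → ℂ → ℂ} (hh : ∀ j, ∀ z ∈ U, B (h j z) = B z)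
    {G : (Fin d → ℂ) → (Fin d → ℂ)}
    (hG : ∀ z : Fin d → ℂ, (∀ i, z i ∈ U) → G (symmMap d z) = symmMap d fun i => h i (z i))
    (k l : Fin d) : EqOn (h k) (h l) U := by
  intro ζ hζ
  obtain ⟨ξ, hξ, hne⟩ := hU ζ
  let v (k : Fin d) : Fin d → ℂ := Function.update (fun _ => ξ) k ζ
  have hv (k i : Fin d) : v k i ∈ U := by
    by_cases hik : i = k
    · subst hik; simpa [v] using hζ
    · simpa [v, hik] using hξ
  have hswap : v k ∘ Equiv.swap k l = v l := by
    funext i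
    simp only [v, Function.comp_apply, Function.update_apply, Equiv.swap_apply_eq_iff,
      Equiv.swap_apply_left]
  have hs : symmMap d (fun i => h i (v k i)) = symmMap d fun i => h i (v l i) := by
    rw [← hG _ (hv k), ← hG _ (hv l), ← hswap, symmMap_comp_equiv]
  obtain ⟨σ, hσ⟩ := exists_equiv_of_symmMap_eq hs
  have hk := hσ k
  have hkk : v k k = ζ := by simp [v]
  have hB := congrArg B hk
  rw [hh _ _ (hv _ _), hh _ _ (hv _ _), hkk] at hB
  have hζ' := hinj (hv _ _) hζ hB
  have hσk : σ k = l := by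
    by_contra hσk
    exact hne (by simpa [v, hσk] using hζ')
  rw [hkk, hζ', hσk] at hk
  exact hk.symm

theorem exists_ball_eq_symmMap_comp {d : ℕ} {B : ℂ → ℂ}
    (hB : DifferentiableOn ℂ B (ball 0 1)) (hnc : ¬ ∃ c, ∀ z ∈ ball (0 : ℂ) 1, B z = c)
    (hd : 0 < d) {Φ : (Fin d → ℂ) → (Fin d → ℂ)} (hΦ : DifferentiableOn ℂ Φ (symPolydisc d))
    (hm : MapsTo Φ (symPolydisc d) (symPolydisc d))
    (hΦB : ∀ z ∈ polydisc d, ∀ w ∈ polydisc d, symmMap d w = Φ (symmMap d z) →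
      symmMap d (fun i => B (w i)) = symmMap d fun i => B (z i)) :
    ∃ z₀ : ℂ, ∃ δ > 0, ball z₀ δ ⊆ ball 0 1 ∧ ∃ H : ℂ → ℂ, DifferentiableOn ℂ H (ball z₀ δ) ∧
      ∀ z : Fin d → ℂ, (∀ i, z i ∈ ball z₀ δ) → Φ (symmMap d z) = symmMap d fun i => H (z i) := by
  obtain ⟨z₀, hz₀, hder⟩ := exists_fiber_deriv_ne_zero hB hnc
  have han : AnalyticOnNhd ℂ B (ball 0 1) := hB.analyticOnNhd isOpen_ball
  have hsm : MapsTo (symmMap d) (polydisc d) (symPolydisc d) := mapsTo_image _ _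
  have hΦs : DifferentiableOn ℂ (fun z => Φ (symmMap d z)) (polydisc d) :=
    hΦ.comp (differentiable_symmMap d).differentiableOn hsm
  have hc₀ : (fun _ => z₀) ∈ polydisc d := fun _ => hz₀
  obtain ⟨w₀, hw₀, hw₀Φ⟩ := hm (hsm hc₀)
  have hBw (j : Fin d) : B (w₀ j) = B z₀ := by
    obtain ⟨σ, hσ⟩ := exists_equiv_of_symmMap_eq (hΦB _ hc₀ _ hw₀ hw₀Φ)
    exact (hσ j).symm
  have hdw (j : Fin d) : deriv B (w₀ j) ≠ 0 := hder _ (hw₀ j) (hBw j)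
  let L (j : Fin d) : ℂ → ℂ := (han _ (hw₀ j)).hasStrictDerivAt.localInverse _ _ _ (hdw j)
  have hLan (j : Fin d) : AnalyticAt ℂ (L j ∘ B) z₀ := by
    refine AnalyticAt.comp ?_ (han _ hz₀)
    rw [← hBw j]
    exact (han _ (hw₀ j)).analyticAt_localInverse (hdw j)
  have hLr (j : Fin d) : ∀ᶠ z in 𝓝 z₀, B (L j (B z)) = B z := by
    have : ∀ᶠ y in 𝓝 (B (w₀ j)), B (L j y) = y :=
      HasStrictDerivAt.eventually_right_inverse ..
    rw [hBw j] at this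
    exact (han _ hz₀).continuousAt.eventually this
  have hroots : ∀ᶠ z in 𝓝 (fun _ : Fin d => z₀), ∀ w ∈ polydisc d,
      symmMap d w = Φ (symmMap d z) → ∀ k, ∃ j, L j (B (w k)) = w k := by
    have := eventually_forall_exists_mem_of_symmMap_eq (w₀ := w₀)
      (N := fun j => {x | L j (B x) = x}) fun j =>
        HasStrictDerivAt.eventually_left_inverse (han _ (hw₀ j)).hasStrictDerivAt (hdw j)
    rw [hw₀Φ] at this
    exact (hΦs.continuousOn.continuousAt ((isOpen_polydisc d).mem_nhds hc₀)).eventually this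
  have hloc : ∀ᶠ z in 𝓝 z₀, z ∈ ball (0 : ℂ) 1 ∧ (∀ j, B (L j (B z)) = B z) ∧
      (∀ j, AnalyticAt ℂ (L j ∘ B) z) ∧
      (han _ hz₀).hasStrictDerivAt.localInverse _ _ _ (hder _ hz₀ rfl) (B z) = z :=
    (isOpen_ball.eventually_mem hz₀).and <| (eventually_all.2 hLr).and <|
      (eventually_all.2 fun j => (hLan j).eventually_analyticAt).and <|
        HasStrictDerivAt.eventually_left_inverse ..
  obtain ⟨δ₁, hδ₁, h₁⟩ := Metric.eventually_nhds_iff_ball.1 hloc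
  obtain ⟨δ₂, hδ₂, h₂⟩ := Metric.eventually_nhds_iff_ball.1 hroots
  set δ := min δ₁ δ₂ with hδdef
  have hδ : 0 < δ := lt_min hδ₁ hδ₂
  have hsub : ball z₀ δ ⊆ ball z₀ δ₁ := ball_subset_ball (min_le_left _ _)
  let V : Set (Fin d → ℂ) := Set.pi univ fun _ => ball z₀ δ
  have hVo : IsOpen V := isOpen_set_pi finite_univ fun _ _ => isOpen_ball
  have hVc : Convex ℝ V := convex_pi fun _ _ => convex_ball _ _
  have hVp : V ⊆ polydisc d := fun z hz i => (h₁ _ (hsub (hz i trivial))).1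
  have hcomp (q : Fin d → Fin d) :
      DifferentiableOn ℂ (fun z : Fin d → ℂ => symmMap d fun i => L (q i) (B (z i))) V := by
    refine (differentiable_symmMap d).comp_differentiableOn (differentiableOn_pi.2 fun i => ?_)
    intro z hz
    have : DifferentiableAt ℂ (L (q i) ∘ B) (z i) :=
      ((h₁ _ (hsub (hz i trivial))).2.2.1 _).differentiableAt
    exact (DifferentiableAt.comp z (f := fun z : Fin d → ℂ => z i) this
      (differentiableAt_apply i z)).differentiableWithinAt
  obtain ⟨q, hq⟩ := exists_eqOn_of_forall_exists_eq hVo hVc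
    ⟨fun _ => z₀, fun _ _ => mem_ball_self hδ⟩ (hΦs.mono hVp) hcomp <| by
      intro z hz
      obtain ⟨w, hw, hwΦ⟩ := hm (hsm (hVp hz))
      obtain ⟨σ, hσ⟩ := exists_equiv_of_symmMap_eq (hΦB _ (hVp hz) _ hw hwΦ).symm
      have hz₂ : z ∈ ball (fun _ : Fin d => z₀) δ₂ :=
        mem_ball.2 <| (dist_pi_lt_iff hδ₂).2 fun i =>
          (mem_ball.1 (hz i trivial)).trans_le (min_le_right _ _)
      choose p hp using h₂ z hz₂ w hw hwΦ
      refine ⟨fun i => p (σ i), ?_⟩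
      beta_reduce
      rw [← hwΦ, ← symmMap_comp_equiv w σ]
      congr 1
      funext i
      rw [← hσ i, hp, Function.comp_apply]
  have hinj : InjOn B (ball z₀ δ) := by
    intro x hx y hy hxy
    rw [← (h₁ x (hsub hx)).2.2.2, ← (h₁ y (hsub hy)).2.2.2, hxy]
  have hpt : ∀ ζ, ∃ ξ ∈ ball z₀ δ, ξ ≠ ζ := by
    intro ζ
    have hinf : (ball z₀ δ).Infinite := infinite_of_mem_nhds z₀ (ball_mem_nhds z₀ hδ)
    obtain ⟨ξ, hξ, hne⟩ := (hinf.sdiff (finite_singleton ζ)).nonempty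
    exact ⟨ξ, hξ, hne⟩
  have heq := eqOn_of_forall_eq_symmMap hpt hinj (h := fun i => L (q i) ∘ B) (G := Φ)
    (fun j z hz => (h₁ z (hsub hz)).2.1 _) (fun z hz => hq fun i _ => hz i)
  refine ⟨z₀, δ, hδ, fun z hz => (h₁ z (hsub hz)).1, L (q ⟨0, hd⟩) ∘ B,
    fun z hz => ((h₁ z (hsub hz)).2.2.1 _).differentiableAt.differentiableWithinAt,
    fun z hz => ?_⟩
  refine (hq fun i _ => hz i).trans (congrArg (symmMap d) (funext fun i => ?_))
  exact heq i _ (hz i)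

/-- A holomorphic self-map of `G_d` lying over the identity of `B` acts diagonally. -/
theorem exists_eq_symmMap_comp {d : ℕ} {B : ℂ → ℂ}
    (hB : DifferentiableOn ℂ B (ball 0 1)) (hnc : ¬ ∃ c, ∀ z ∈ ball (0 : ℂ) 1, B z = c)
    (hd : 0 < d) {Φ : (Fin d → ℂ) → (Fin d → ℂ)} (hΦ : DifferentiableOn ℂ Φ (symPolydisc d))
    (hm : MapsTo Φ (symPolydisc d) (symPolydisc d))
    (hΦB : ∀ z ∈ polydisc d, ∀ w ∈ polydisc d, symmMap d w = Φ (symmMap d z) →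
      symmMap d (fun i => B (w i)) = symmMap d fun i => B (z i)) :
    ∃ h : ℂ → ℂ, DifferentiableOn ℂ h (ball 0 1) ∧ MapsTo h (ball 0 1) (ball 0 1) ∧
      (∀ z ∈ ball (0 : ℂ) 1, B (h z) = B z) ∧
      ∀ z ∈ polydisc d, Φ (symmMap d z) = symmMap d fun i => h (z i) := by
  obtain ⟨z₀, δ, hδ, hsub, H, -, hH⟩ := exists_ball_eq_symmMap_comp hB hnc hd hΦ hm hΦB
  have hsm : MapsTo (symmMap d) (polydisc d) (symPolydisc d) := mapsTo_image _ _
  have hΦs : DifferentiableOn ℂ (fun z => Φ (symmMap d z)) (polydisc d) :=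
    hΦ.comp (differentiable_symmMap d).differentiableOn hsm
  have hd0 : (d : ℂ) ≠ 0 := Nat.cast_ne_zero.2 hd.ne'
  let h : ℂ → ℂ := fun z => Φ (symmMap d fun _ => z) ⟨0, hd⟩ / d
  have hdiag : DifferentiableOn ℂ (fun z : ℂ => Φ (symmMap d fun _ => z)) (ball 0 1) :=
    hΦs.comp (g := fun z => Φ (symmMap d z)) (f := fun z : ℂ => fun _ : Fin d => z)
      (by fun_prop) fun z hz _ => hz
  have hdiff : DifferentiableOn ℂ h (ball 0 1) := (differentiableOn_pi.1 hdiag _).div_const _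
  have hhH : EqOn h H (ball z₀ δ) := by
    intro z hz
    simp only [h]
    rw [hH _ fun _ => hz, symmMap_const_zero hd, mul_div_cancel_left₀ _ hd0]
  have hz₀ : z₀ ∈ ball (0 : ℂ) 1 := hsub (mem_ball_self hδ)
  have hconst : EqOn (fun z : ℂ => Φ (symmMap d fun _ => z)) (fun z => symmMap d fun _ => h z)
      (ball 0 1) := by
    refine eqOn_of_convex_of_eventuallyEq isOpen_ball (convex_ball _ _) hdiag
      ((differentiable_symmMap d).comp_differentiableOn
        (differentiableOn_pi.2 fun _ => hdiff)) hz₀ ?_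
    filter_upwards [ball_mem_nhds z₀ hδ] with z hz
    rw [hH _ fun _ => hz, hhH hz]
  have hmem : ∀ z ∈ ball (0 : ℂ) 1, (fun _ : Fin d => h z) ∈ polydisc d := by
    intro z hz
    obtain ⟨w, hw, hwΦ⟩ := hm (hsm (show (fun _ => z) ∈ polydisc d from fun _ => hz))
    obtain ⟨σ, hσ⟩ := exists_equiv_of_symmMap_eq ((hconst hz).symm.trans hwΦ.symm)
    intro i
    rw [← hσ i]
    exact hw _
  refine ⟨h, hdiff, fun z hz => hmem z hz ⟨0, hd⟩, fun z hz => ?_, ?_⟩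
  · exact eq_of_symmMap_const_eq ⟨0, hd⟩
      (hΦB _ (fun _ => hz) _ (hmem z hz) (hconst hz).symm)
  · refine eqOn_of_convex_of_eventuallyEq (p := fun _ => z₀) (isOpen_polydisc d)
      (convex_polydisc d) hΦs
      ((differentiable_symmMap d).comp_differentiableOn (differentiableOn_pi.2 fun i =>
        hdiff.comp (differentiable_apply i).differentiableOn fun z hz => hz i))
      (fun _ => hz₀) ?_
    filter_upwards [set_pi_mem_nhds finite_univ fun (_ : Fin d) _ => ball_mem_nhds z₀ hδ]
      with z hz
    rw [hH z fun i => hz i trivial]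
    congr 1
    funext i
    exact (hhH (hz i trivial)).symm

theorem differentiableOn_of_eq_blaschke {m : ℕ} {lam : ℂ} {a : Fin m → ℂ} (ha : ∀ j, ‖a j‖ < 1)
    {B : ℂ → ℂ}
    (hB : ∀ z : ℂ, B z = lam * ∏ j, (z - a j) / (1 - (starRingEnd ℂ) (a j) * z)) :
    DifferentiableOn ℂ B (ball 0 1) := by
  rw [funext hB]
  refine (DifferentiableOn.fun_finsetProd fun j _ => ?_).const_mul _
  refine DifferentiableOn.div (by fun_prop) (by fun_prop) fun z hz h => ?_
  have hz1 : ‖z‖ < 1 := mem_ball_zero_iff.1 hz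
  have h1 : ‖(starRingEnd ℂ) (a j) * z‖ < 1 := by
    rw [norm_mul, RCLike.norm_conj]
    exact mul_lt_one_of_nonneg_of_lt_one_left (norm_nonneg _) (ha j) hz1.le
  rw [← sub_eq_zero.1 h, norm_one] at h1
  exact lt_irrefl _ h1

/-- if `B₀` is a finite Blaschke product with trivial deck group and
`f : G_d → G_d` is the proper holomorphic map with `f∘s = s∘(B₀,…,B₀)`, then every
biholomorphism `Φ` of `G_d` with `f∘Φ = f` is the identity of `G_d`. -/
theorem stmt13 (d : ℕ) (m : ℕ) (lam : ℂ) (hlam : ‖lam‖ = 1) (a : Fin m → ℂ)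
    (ha : ∀ j, ‖a j‖ < 1)
    (B₀ : ℂ → ℂ)
    (hB₀ : ∀ z : ℂ, B₀ z = lam * ∏ j, (z - a j) / (1 - (starRingEnd ℂ) (a j) * z))
    (htrivial : ∀ φ : ℂ → ℂ, DifferentiableOn ℂ φ (ball (0 : ℂ) 1) →
      Set.BijOn φ (ball (0 : ℂ) 1) (ball (0 : ℂ) 1) →
      (∀ z ∈ ball (0 : ℂ) 1, B₀ (φ z) = B₀ z) →
      ∀ z ∈ ball (0 : ℂ) 1, φ z = z)
    (f : (Fin d → ℂ) → (Fin d → ℂ))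
    (hf : DifferentiableOn ℂ f (symPolydisc d))
    (hfm : Set.MapsTo f (symPolydisc d) (symPolydisc d))
    (hff : ∀ z ∈ polydisc d, f (symmMap d z) = symmMap d (fun i => B₀ (z i))) :
    ∀ Φ Ψ : (Fin d → ℂ) → (Fin d → ℂ),
      DifferentiableOn ℂ Φ (symPolydisc d) →
      Set.MapsTo Φ (symPolydisc d) (symPolydisc d) →
      DifferentiableOn ℂ Ψ (symPolydisc d) →
      Set.MapsTo Ψ (symPolydisc d) (symPolydisc d) →
      (∀ w ∈ symPolydisc d, Ψ (Φ w) = w) → (∀ w ∈ symPolydisc d, Φ (Ψ w) = w) →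
      (∀ w ∈ symPolydisc d, f (Φ w) = f w) →
      ∀ w ∈ symPolydisc d, Φ w = w := by
  intro Φ Ψ hΦ hΦm hΨ hΨm hΨΦ hΦΨ hfΦ
  rcases Nat.eq_zero_or_pos d with rfl | hd
  · exact fun w _ => Subsingleton.elim _ _
  have hB := differentiableOn_of_eq_blaschke ha hB₀
  have hnc : ¬ ∃ c, ∀ z ∈ ball (0 : ℂ) 1, B₀ z = c := by
    rintro ⟨c, hc⟩
    have hneg : MapsTo (fun z : ℂ => -z) (ball 0 1) (ball 0 1) := fun z hz => by simpa using hz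
    have := htrivial (fun z => -z) (by fun_prop)
      ⟨hneg, neg_injective.injOn, fun z hz => ⟨-z, hneg hz, neg_neg z⟩⟩
      (fun z hz => by rw [hc _ (hneg hz), hc z hz]) (1 / 2) (by simp; norm_num)
    norm_num at this
  have hfΨ : ∀ w ∈ symPolydisc d, f (Ψ w) = f w := fun w hw => by
    rw [← hfΦ _ (hΨm hw), hΦΨ w hw]
  have hover {Θ : (Fin d → ℂ) → (Fin d → ℂ)} (hΘ : ∀ w ∈ symPolydisc d, f (Θ w) = f w) :
      ∀ z ∈ polydisc d, ∀ w ∈ polydisc d, symmMap d w = Θ (symmMap d z) →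
        symmMap d (fun i => B₀ (w i)) = symmMap d fun i => B₀ (z i) := by
    intro z hz w hw hwz
    rw [← hff w hw, ← hff z hz, hwz, hΘ _ (mem_image_of_mem _ hz)]
  obtain ⟨h, hh, hhm, hBh, hΦh⟩ := exists_eq_symmMap_comp hB hnc hd hΦ hΦm (hover hfΦ)
  obtain ⟨k, -, hkm, -, hΨk⟩ := exists_eq_symmMap_comp hB hnc hd hΨ hΨm (hover hfΨ)
  have hdiag {z : ℂ} (hz : z ∈ ball (0 : ℂ) 1) : (fun _ => z) ∈ polydisc d := fun _ => hz
  have hkh : LeftInvOn k h (ball 0 1) := fun z hz => by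
    refine eq_of_symmMap_const_eq ⟨0, hd⟩ ?_
    rw [← hΨk _ (hdiag (hhm hz)), ← hΦh _ (hdiag hz), hΨΦ _ (mem_image_of_mem _ (hdiag hz))]
  have hhk : LeftInvOn h k (ball 0 1) := fun z hz => by
    refine eq_of_symmMap_const_eq ⟨0, hd⟩ ?_
    rw [← hΦh _ (hdiag (hkm hz)), ← hΨk _ (hdiag hz), hΦΨ _ (mem_image_of_mem _ (hdiag hz))]
  have hid := htrivial h hh (InvOn.bijOn ⟨hkh, hhk⟩ hhm hkm) hBh
  rintro _ ⟨z, hz, rfl⟩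
  rw [hΦh z hz]
  congr 1
  funext i
  exact hid _ (hz i)
end
end
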